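/- arXiv:2502.06290 — 2 statements merged into one kernel-verified Lean document; each statement's English description precedes it below -/
import Mathlib

section
/- Let f ∈ ℂ[x₀,x₁,x₂] be homogeneous of degree d ≥ 2 such that the curve C = V(f) ⊆ ℙ² has only isolated singularities (i.e. f is reduced) and no singular point of C lies on the line x₀ = 0. Set g(y₁,y₂) = f(1,y₁,y₂) with partials g₁, g₂. Let ρ₁,…,ρ_m generate the R-module Syz(J_f) of Jacobian syzygies and let M_f be the 3×m matrix with columns ρⱼ. Then dim_ℂ ℂ[y₁,y₂]/(g, g₁, g₂) = dim_ℂ ℂ[y₁,y₂]/(g², g₁, g₂) (i.e. μ(C) = τ(C)) if and only if the evaluated matrix M_f(q) is nonzero (rank ≥ 1) for every q ∈ ℂ³ ∖ {0}. -/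
open MvPolynomial

noncomputable section

/-- Dehomogenization with respect to `x₀`: substitute `x₀ = 1`, `xᵢ = yᵢ`. -/
def deh (n : ℕ) : MvPolynomial (Fin (n + 1)) ℂ →ₐ[ℂ] MvPolynomial (Fin n) ℂ :=
  aeval (fun i => Fin.cases 1 (fun j => X j) i)

lemma pderiv_pderiv_comm' (i k : Fin 2) (F : MvPolynomial (Fin 2) ℂ) :
    pderiv i (pderiv k F) = pderiv k (pderiv i F) := by
  induction F using MvPolynomial.induction_on with
  | C r => simp
  | add p q hp hq => simp [hp, hq]
  | mul_X p l hp =>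
    have h1 : ∀ u v : Fin 2, pderiv u (pderiv v (X l : MvPolynomial (Fin 2) ℂ)) = 0 := by
      intro u v
      by_cases h : l = v
      · subst h; simp
      · simp [pderiv_X, Pi.single_apply, h]
    simp only [Derivation.leibniz, smul_eq_mul, map_add, hp, h1]
    ring

lemma aux_monic {I : Ideal (MvPolynomial (Fin 2) ℂ)} (h : (zeroLocus ℂ I).Finite) (i : Fin 2) :
    ∃ P : Polynomial ℂ, P.Monic ∧ Polynomial.aeval (X i : MvPolynomial (Fin 2) ℂ) P ∈ I := by
  set P : Polynomial ℂ := ∏ s ∈ h.toFinset, (Polynomial.X - Polynomial.C (s i)) with hP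
  have hm : P.Monic := Polynomial.monic_prod_of_monic _ _ fun s _ => Polynomial.monic_X_sub_C _
  have hv : Polynomial.aeval (X i : MvPolynomial (Fin 2) ℂ) P ∈ I.radical := by
    rw [← vanishingIdeal_zeroLocus_eq_radical (K := ℂ) I, mem_vanishingIdeal_iff]
    intro x hx
    rw [hP, map_prod, map_prod]
    apply Finset.prod_eq_zero (i := x) (by simpa using hx)
    simp
  obtain ⟨n, hn⟩ := hv
  exact ⟨P ^ n, hm.pow n, by simpa using hn⟩

lemma aux_finite {I : Ideal (MvPolynomial (Fin 2) ℂ)} (h : (zeroLocus ℂ I).Finite) :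
    Module.Finite ℂ (MvPolynomial (Fin 2) ℂ ⧸ I) := by
  have key : ∀ a : MvPolynomial (Fin 2) ℂ, IsIntegral ℂ (Ideal.Quotient.mkₐ ℂ I a) := by
    intro a
    induction a using MvPolynomial.induction_on with
    | C r =>
      rw [← MvPolynomial.algebraMap_eq, AlgHom.commutes]
      exact isIntegral_algebraMap
    | add p q hp hq => rw [map_add]; exact hp.add hq
    | mul_X p i hp =>
      rw [map_mul]
      refine hp.mul ?_
      obtain ⟨P, hm, hP⟩ := aux_monic h i
      refine ⟨P, hm, ?_⟩
      rw [← Polynomial.aeval_def, Polynomial.aeval_algHom_apply]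
      exact Ideal.Quotient.eq_zero_iff_mem.2 hP
  haveI : Algebra.IsIntegral ℂ (MvPolynomial (Fin 2) ℂ ⧸ I) := ⟨fun x => by
    obtain ⟨a, rfl⟩ := Ideal.Quotient.mk_surjective x
    exact key a⟩
  exact Algebra.IsIntegral.finite

/-- A derivation-stable ideal of finite colength: the derivation vanishes at each zero. -/
lemma aux_deriv {I : Ideal (MvPolynomial (Fin 2) ℂ)} (h : (zeroLocus ℂ I).Finite)
    (D : Derivation ℂ (MvPolynomial (Fin 2) ℂ) (MvPolynomial (Fin 2) ℂ))
    (hD : ∀ a ∈ I, D a ∈ I) (p : Fin 2 → ℂ) (hp : p ∈ zeroLocus ℂ I) (i : Fin 2) :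
    eval p (D (X i)) = 0 := by
  by_contra hne
  set x : MvPolynomial (Fin 2) ℂ := X i - C (p i) with hx
  have hDx : D x = D (X i) := by
    rw [hx, map_sub, ← MvPolynomial.algebraMap_eq, Derivation.map_algebraMap, sub_zero]
  have hI : ∀ a ∈ I, eval p a = 0 := fun a ha => by
    have := hp a ha
    rwa [MvPolynomial.aeval_eq_eval] at this
  have hno : ∀ k : ℕ, ¬ ∃ e : MvPolynomial (Fin 2) ℂ, eval p e ≠ 0 ∧ e * x ^ k ∈ I := by
    intro k
    induction k with
    | zero => 
      rintro ⟨e, he, hm⟩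
      exact he (hI e (by simpa using hm))
    | succ k ih =>
      rintro ⟨e, he, hm⟩
      apply ih
      refine ⟨((k + 1 : ℕ) : MvPolynomial (Fin 2) ℂ) * e ^ 2 * D x, ?_, ?_⟩
      · rw [hDx]
        simp only [map_mul, map_pow, map_natCast]
        exact mul_ne_zero (mul_ne_zero (Nat.cast_ne_zero.2 (Nat.succ_ne_zero k)) (pow_ne_zero 2 he)) hne
      · have h1 := hD _ hm
        have h2 : D (e * x ^ (k+1)) = e * (((k + 1 : ℕ) : MvPolynomial (Fin 2) ℂ) * x ^ k * D x) 
            + x ^ (k+1) * D e := by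
          rw [Derivation.leibniz, Derivation.leibniz_pow]
          simp [mul_assoc]
        have h3 := I.sub_mem (I.mul_mem_left e h1) (I.mul_mem_left (D e) hm)
        rw [h2] at h3
        convert h3 using 1
        ring
  obtain ⟨P, hm, hP⟩ := aux_monic h i
  obtain ⟨Q, hQ, hQ'⟩ := Polynomial.exists_eq_pow_rootMultiplicity_mul_and_not_dvd P hm.ne_zero (p i)
  apply hno (Polynomial.rootMultiplicity (p i) P)
  refine ⟨Polynomial.aeval (X i) Q, ?_, ?_⟩
  · rw [Polynomial.dvd_iff_isRoot, Polynomial.IsRoot] at hQ'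
    have : eval p (Polynomial.aeval (X i : MvPolynomial (Fin 2) ℂ) Q) = Polynomial.eval (p i) Q := by
      have := Polynomial.aeval_algHom_apply (MvPolynomial.aeval p) (X i : MvPolynomial (Fin 2) ℂ) Q
      rw [MvPolynomial.aeval_eq_eval] at this
      simpa using this.symm
    rwa [this]
  · rw [hQ] at hP
    rw [hx, mul_comm]
    simpa using hP

lemma deh_pderiv (j : Fin 2) (f : MvPolynomial (Fin 3) ℂ) :
    pderiv j (deh 2 f) = deh 2 (pderiv j.succ f) := by
  induction f using MvPolynomial.induction_on with
  | C r => simp [deh]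
  | add p q hp hq => simp [hp, hq]
  | mul_X p i hp =>
    have hX : pderiv j (deh 2 (X i)) = deh 2 (pderiv j.succ (X i)) := by
      refine Fin.cases ?_ (fun l => ?_) i
      · simp [deh, pderiv_X, Pi.single_apply]
      · by_cases h : l = j
        · subst h; simp [deh]
        · simp [deh, pderiv_X, Pi.single_apply, h]
    simp [Derivation.leibniz, hp, hX]

lemma eval_deh (p : Fin 2 → ℂ) (f : MvPolynomial (Fin 3) ℂ) :
    eval p (deh 2 f) = eval (Fin.cons 1 p : Fin 3 → ℂ) f := by
  induction f using MvPolynomial.induction_on with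
  | C r => simp [deh]
  | add p q hp hq => simp [hp, hq]
  | mul_X q i hq =>
    rw [map_mul, map_mul, map_mul, hq]
    congr 1
    refine Fin.cases ?_ (fun l => ?_) i <;> simp [deh]

lemma eval_smul_homog {n : ℕ} {F : MvPolynomial (Fin 3) ℂ} (hF : F.IsHomogeneous n) (c : ℂ)
    (q : Fin 3 → ℂ) : eval (c • q) F = c ^ n * eval q F := by
  rw [eval_eq, eval_eq, Finset.mul_sum]
  refine Finset.sum_congr rfl fun s hs => ?_
  have h := hF.degree_eq_sum_deg_support hs
  simp only [Pi.smul_apply, smul_eq_mul, mul_pow, Finset.prod_mul_distrib, Finset.prod_pow_eq_pow_sum]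
  rw [← h]
  ring

lemma pt_smul (q : Fin 3 → ℂ) (h : q 0 ≠ 0) :
    q = q 0 • (Fin.cons 1 (fun i : Fin 2 => q i.succ / q 0) : Fin 3 → ℂ) := by
  funext i
  refine Fin.cases ?_ (fun l => ?_) i
  · simp
  · simp; field_simp

lemma deh_inj {n : ℕ} {F : MvPolynomial (Fin 3) ℂ} (hF : F.IsHomogeneous n)
    (h : deh 2 F = 0) : F = 0 := by
  have : X 0 * F = 0 := by
    apply MvPolynomial.funext
    intro q
    by_cases hq : q 0 = 0
    · simp [hq]
    · rw [map_mul, pt_smul q hq, eval_smul_homog hF, ← eval_deh, h]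
      simp
  exact (mul_eq_zero.1 this).resolve_left (X_ne_zero 0)

lemma exists_homog (a : MvPolynomial (Fin 2) ℂ) (N : ℕ) (hN : a.totalDegree ≤ N) :
    ∃ A : MvPolynomial (Fin 3) ℂ, A.IsHomogeneous N ∧ deh 2 A = a := by
  refine ⟨∑ s ∈ a.support, X 0 ^ (N - s.degree) * rename Fin.succ (monomial s (coeff s a)), ?_, ?_⟩
  · apply IsHomogeneous.sum
    intro s hs
    have hsN : s.degree ≤ N := le_trans (le_totalDegree hs) hN
    have := (isHomogeneous_X_pow (R := ℂ) (0 : Fin 3) (N - s.degree)).mul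
      ((isHomogeneous_monomial (coeff s a) (rfl : s.degree = s.degree)).rename_isHomogeneous
        (f := (Fin.succ : Fin 2 → Fin 3)))
    rwa [Nat.sub_add_cancel hsN] at this
  · have h0 : deh 2 (X 0) = 1 := by simp [deh]
    have h1 : ∀ b : MvPolynomial (Fin 2) ℂ, deh 2 (rename Fin.succ b) = b := by
      intro b
      rw [deh, aeval_rename]
      exact aeval_X_left_apply b
    rw [map_sum]
    simp only [map_mul, map_pow, h0, h1, one_pow, one_mul]
    exact support_sum_monomial_coeff a

lemma deh_euler {d : ℕ} {f : MvPolynomial (Fin 3) ℂ} (hf : f.IsHomogeneous d) :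
    deh 2 (pderiv 0 f) + X 0 * pderiv 0 (deh 2 f) + X 1 * pderiv 1 (deh 2 f) =
      (d : MvPolynomial (Fin 2) ℂ) * deh 2 f := by
  have := congrArg (deh 2) hf.sum_X_mul_pderiv
  rw [Fin.sum_univ_three] at this
  rw [deh_pderiv, deh_pderiv]
  have h0 : deh 2 (X 0) = 1 := by simp [deh]
  have h1 : deh 2 (X 1) = X 0 := by
    rw [deh, aeval_X]; rfl
  have h2 : deh 2 (X 2) = X 1 := by
    rw [deh, aeval_X]; rfl
  simpa [h0, h1, h2] using this

set_option maxHeartbeats 1000000 in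
/-- Theorem 4.8 (global form): for a reduced plane curve `C = V(f) ⊆ ℙ²` of degree `d ≥ 2`
with only isolated singularities, none on the line `x₀ = 0`, and `ρ₁,…,ρ_m` generators of
`Syz(J_f)` (columns of a first syzygy matrix `M_f`), one has
`dim_ℂ ℂ[y]/(g,g₁,g₂) = dim_ℂ ℂ[y]/(g²,g₁,g₂)` (i.e. `μ(C) = τ(C)`) iff the evaluated matrix
`M_f(q)` is nonzero for every `q ∈ ℂ³ ∖ {0}`. -/
theorem stmt_13 (d m : ℕ) (hd : 2 ≤ d) (f : MvPolynomial (Fin 3) ℂ)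
    (hf : f.IsHomogeneous d) (hred : Squarefree f)
    (hiso : {P : Projectivization ℂ (Fin 3 → ℂ) |
      ∀ i, eval P.rep (pderiv i f) = 0}.Finite)
    (hx0 : ∀ q : Fin 3 → ℂ, q ≠ 0 → (∀ i, eval q (pderiv i f) = 0) → q 0 ≠ 0)
    (ρ : Fin m → Fin 3 → MvPolynomial (Fin 3) ℂ)
    (hsyz : ∀ j, ∑ i, ρ j i * pderiv i f = 0)
    (hgen : ∀ A : Fin 3 → MvPolynomial (Fin 3) ℂ,
      (∑ i, A i * pderiv i f = 0) →
        A ∈ Submodule.span (MvPolynomial (Fin 3) ℂ) (Set.range ρ)) :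
    (Module.finrank ℂ (MvPolynomial (Fin 2) ℂ ⧸
        Ideal.span ({deh 2 f} ∪ Set.range fun j : Fin 2 => pderiv j (deh 2 f))) =
      Module.finrank ℂ (MvPolynomial (Fin 2) ℂ ⧸
        Ideal.span ({(deh 2 f) ^ 2} ∪ Set.range fun j : Fin 2 => pderiv j (deh 2 f)))) ↔
      ∀ q : Fin 3 → ℂ, q ≠ 0 → ∃ j i, eval q (ρ j i) ≠ 0 := by
  have hd0 : (d : ℂ) ≠ 0 := Nat.cast_ne_zero.2 (by omega)
  have heul := deh_euler hf
  have hpd1 : pderiv (0 : Fin 2) (deh 2 f) = deh 2 (pderiv 1 f) := deh_pderiv 0 f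
  have hpd2 : pderiv (1 : Fin 2) (deh 2 f) = deh 2 (pderiv 2 f) := deh_pderiv 1 f
  set g := deh 2 f with hg
  set I1 := Ideal.span ({g} ∪ Set.range fun j : Fin 2 => pderiv j g) with hI1
  set I2 := Ideal.span ({g ^ 2} ∪ Set.range fun j : Fin 2 => pderiv j g) with hI2
  have hg1 : g ∈ I1 := Ideal.subset_span (Or.inl rfl)
  have hj1 : ∀ j, pderiv j g ∈ I1 := fun j => Ideal.subset_span (Or.inr ⟨j, rfl⟩)
  have hg2 : g ^ 2 ∈ I2 := Ideal.subset_span (Or.inl rfl)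
  have hj2 : ∀ j, pderiv j g ∈ I2 := fun j => Ideal.subset_span (Or.inr ⟨j, rfl⟩)
  have hle : I2 ≤ I1 := by
    rw [hI2, Ideal.span_le]
    rintro a (ha | ⟨j, rfl⟩)
    · rw [Set.mem_singleton_iff.1 ha]; exact Ideal.pow_mem_of_mem _ hg1 2 (by norm_num)
    · exact hj1 j
  have hcons : ∀ p : Fin 2 → ℂ, (Fin.cons 1 p : Fin 3 → ℂ) ≠ 0 := fun p h => by
    have := congrFun h 0
    simp at this
  -- zeros of I2 are singular points
  have hz2 : ∀ p ∈ zeroLocus ℂ I2, eval p g = 0 ∧ (∀ j, eval p (pderiv j g) = 0) ∧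
      ∀ i, eval (Fin.cons 1 p : Fin 3 → ℂ) (pderiv i f) = 0 := by
    intro p hp
    have e : ∀ a ∈ I2, eval p a = 0 := fun a ha => by
      have := hp a ha
      rwa [MvPolynomial.aeval_eq_eval] at this
    have e0 : eval p g = 0 := by
      have := e _ hg2
      rw [map_pow] at this
      exact pow_eq_zero_iff (by norm_num) |>.1 this
    have e1 : ∀ j, eval p (pderiv j g) = 0 := fun j => e _ (hj2 j)
    refine ⟨e0, e1, fun i => ?_⟩
    rw [← eval_deh]
    refine Fin.cases ?_ (fun l => ?_) i
    · have := congrArg (eval p) heul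
      simpa [e0, e1] using this
    · rw [← deh_pderiv]; exact e1 l
  have hzfin : (zeroLocus ℂ I2).Finite := by
    refine Set.Finite.of_finite_image (f := fun p => Projectivization.mk ℂ (Fin.cons 1 p : Fin 3 → ℂ) (hcons p))
      (hiso.subset ?_) ?_
    · rintro _ ⟨p, hp, rfl⟩ i
      obtain ⟨c, hc⟩ := Projectivization.exists_smul_eq_mk_rep ℂ (Fin.cons 1 p : Fin 3 → ℂ) (hcons p)
      have hc' : (c : ℂ) • (Fin.cons 1 p : Fin 3 → ℂ) = _ := hc
      rw [← hc', eval_smul_homog hf.pderiv, (hz2 p hp).2.2 i, mul_zero]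
    · intro p _ q _ h
      obtain ⟨c, hc⟩ := (Projectivization.mk_eq_mk_iff' ℂ _ _ _ _).1 h
      have c1 : c = 1 := by simpa using congrFun hc 0
      funext i
      have := congrFun hc i.succ
      simpa [c1] using this.symm
  have hzfin1 : (zeroLocus ℂ I1).Finite := hzfin.subset (zeroLocus_anti_mono hle)
  haveI := aux_finite hzfin
  have hfr : Module.finrank ℂ (MvPolynomial (Fin 2) ℂ ⧸ I1) =
      Module.finrank ℂ (MvPolynomial (Fin 2) ℂ ⧸ I2) ↔ g ∈ I2 := by
    constructor
    · intro h
      have hs : Function.Surjective (Ideal.Quotient.factorₐ ℂ hle).toLinearMap :=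
        Ideal.Quotient.factor_surjective hle
      haveI := aux_finite hzfin1
      have hi := (LinearMap.injective_iff_surjective_of_finrank_eq_finrank h.symm).2 hs
      rw [← Ideal.Quotient.eq_zero_iff_mem]
      apply hi
      rw [map_zero]
      exact Ideal.Quotient.eq_zero_iff_mem.2 hg1
    · intro h
      have : I1 = I2 := by
        refine le_antisymm ?_ hle
        rw [hI1, Ideal.span_le]
        rintro a (ha | ⟨j, rfl⟩)
        · rw [Set.mem_singleton_iff.1 ha]; exact h
        · exact hj2 j
      rw [this]
  rw [hfr]
  have hvan : ∀ q : Fin 3 → ℂ, (∀ j i, eval q (ρ j i) = 0) → ∀ A : Fin 3 → MvPolynomial (Fin 3) ℂ,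
      (∑ i, A i * pderiv i f = 0) → ∀ i, eval q (A i) = 0 := by
    intro q hq A hA
    have hmem := hgen A hA
    clear hA
    induction hmem using Submodule.span_induction with
    | mem x hx => obtain ⟨j, rfl⟩ := hx; exact hq j
    | zero => simp
    | add x y _ _ hx hy => intro i; simp [hx i, hy i]
    | smul a x _ hx => intro i; simp [hx i]
  constructor
  · intro hgI q hq
    by_contra! hcon
    have hv := hvan q hcon
    obtain ⟨h, a, hga⟩ : ∃ (h : MvPolynomial (Fin 2) ℂ) (a : Fin 2 → MvPolynomial (Fin 2) ℂ),
        h * g ^ 2 + (a 0 * pderiv 0 g + a 1 * pderiv 1 g) = g := by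
      rw [hI2, Ideal.span_union, Submodule.mem_sup] at hgI
      obtain ⟨y, hy, z, hz, hyz⟩ := hgI
      obtain ⟨h, rfl⟩ := Ideal.mem_span_singleton'.1 hy
      obtain ⟨a, rfl⟩ := Ideal.mem_span_range_iff_exists_fun.1 hz
      exact ⟨h, a, by rw [Fin.sum_univ_two] at hyz; exact hyz⟩
    have k1 := hv ![pderiv 1 f, - pderiv 0 f, 0] (by
      simp [Fin.sum_univ_three]; ring)
    have k2 := hv ![pderiv 2 f, 0, - pderiv 0 f] (by
      simp [Fin.sum_univ_three]; ring)
    have hsing : ∀ i, eval q (pderiv i f) = 0 := by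
      intro i
      fin_cases i
      · simpa using k1 1
      · simpa using k1 0
      · simpa using k2 0
    have hq0 := hx0 q hq hsing
    have hqp := pt_smul q hq0
    set p : Fin 2 → ℂ := fun i : Fin 2 => q i.succ / q 0 with hp
    have hsp : ∀ i, eval p (deh 2 (pderiv i f)) = 0 := by
      intro i
      have := hsing i
      rw [hqp, eval_smul_homog hf.pderiv] at this
      rw [eval_deh]
      exact (mul_eq_zero.1 this).resolve_left (pow_ne_zero _ hq0)
    have hgp : eval p g = 0 := by
      have := congrArg (eval p) heul
      rw [hpd1, hpd2] at this
      simp only [map_add, map_mul, hsp, mul_zero, add_zero, map_natCast] at this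
      exact (mul_eq_zero.1 this.symm).resolve_left hd0
    set c : Fin 3 → MvPolynomial (Fin 2) ℂ :=
      ![1 - h * g, (1 - h * g) * X 0 - (d : MvPolynomial (Fin 2) ℂ) * a 0, (1 - h * g) * X 1 - (d : MvPolynomial (Fin 2) ℂ) * a 1] with hc
    set N := Finset.univ.sup fun i => (c i).totalDegree with hN
    have hex : ∀ i, ∃ A : MvPolynomial (Fin 3) ℂ, A.IsHomogeneous N ∧ deh 2 A = c i := fun i =>
      exists_homog _ _ (Finset.le_sup (f := fun i => (c i).totalDegree) (Finset.mem_univ i))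
    choose A hA hA' using hex
    have hz := hv A (by
      apply deh_inj (n := N + (d - 1))
      · exact IsHomogeneous.sum _ _ _ fun i _ => (hA i).mul hf.pderiv
      · rw [map_sum, Fin.sum_univ_three]
        simp only [map_mul, hA']
        rw [← hpd1, ← hpd2]
        simp only [hc, Matrix.cons_val_zero, Matrix.cons_val_one, Matrix.cons_val]
        linear_combination (1 - h * g) * heul - (d : MvPolynomial (Fin 2) ℂ) * hga) 0
    rw [hqp, eval_smul_homog (hA 0), ← eval_deh, hA'] at hz
    have : eval p (c 0) = 1 := by simp [hc, hgp]
    rw [this, mul_one] at hz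
    exact pow_ne_zero _ hq0 hz
  · intro hnv
    set K : Ideal (MvPolynomial (Fin 2) ℂ) :=
      Submodule.comap (LinearMap.mulRight (MvPolynomial (Fin 2) ℂ) g) I2 with hK
    have hKm : ∀ a, a ∈ K ↔ a * g ∈ I2 := fun a => Iff.rfl
    suffices hKt : K = ⊤ by
      have := (hKm 1).1 (hKt ▸ Submodule.mem_top)
      rwa [one_mul] at this
    by_contra hKt
    obtain ⟨M, hM, hKM⟩ := Ideal.exists_le_maximal K hKt
    obtain ⟨p, rfl⟩ := (isMaximal_iff_eq_vanishingIdeal_singleton).1 hM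
    have hKp : ∀ a ∈ K, eval p a = 0 := fun a ha => by
      have := (mem_vanishingIdeal_singleton_iff p a).1 (hKM ha)
      rwa [MvPolynomial.aeval_eq_eval] at this
    have hp2 : p ∈ zeroLocus ℂ I2 := fun a ha => by
      rw [MvPolynomial.aeval_eq_eval]
      exact hKp a ((hKm a).2 (I2.mul_mem_right g ha))
    obtain ⟨hgp, hjp, -⟩ := hz2 p hp2
    have hp1 : p ∈ zeroLocus ℂ I1 := by
      rw [hI1, zeroLocus_span]
      rintro a (ha | ⟨j, rfl⟩)
      · rw [Set.mem_singleton_iff.1 ha, MvPolynomial.aeval_eq_eval]; exact hgp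
      · rw [MvPolynomial.aeval_eq_eval]; exact hjp j
    obtain ⟨j, i, hji⟩ := hnv (Fin.cons 1 p) (hcons p)
    rw [← eval_deh] at hji
    have hs := congrArg (deh 2) (hsyz j)
    rw [map_sum, Fin.sum_univ_three] at hs
    simp only [map_mul, map_zero] at hs
    rw [← hpd1, ← hpd2] at hs
    set a0 := deh 2 (ρ j 0) with ha0
    set a1 := deh 2 (ρ j 1) with ha1
    set a2 := deh 2 (ρ j 2) with ha2
    set b0 := a0 * X 0 - a1 with hb0
    set b1 := a0 * X 1 - a2 with hb1
    have hbg : b0 * pderiv 0 g + b1 * pderiv 1 g = d * a0 * g := by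
      rw [hb0, hb1]
      linear_combination a0 * heul - hs
    have hEa : eval p a0 = 0 := by
      have hmem : (d : MvPolynomial (Fin 2) ℂ) * a0 ∈ K := by
        rw [hKm, ← hbg]
        exact I2.add_mem (I2.mul_mem_left _ (hj2 0)) (I2.mul_mem_left _ (hj2 1))
      have := hKp _ hmem
      rw [map_mul, map_natCast] at this
      exact (mul_eq_zero.1 this).resolve_left hd0
    set D : Derivation ℂ (MvPolynomial (Fin 2) ℂ) (MvPolynomial (Fin 2) ℂ) :=
      b0 • pderiv 0 + b1 • pderiv 1 with hD
    have hDa : ∀ x, D x = b0 * pderiv 0 x + b1 * pderiv 1 x := fun x => by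
      simp [hD]
    have hDI : ∀ x ∈ I1, D x ∈ I1 := by
      intro x hx
      rw [hI1] at hx
      induction hx using Submodule.span_induction with
      | mem x hx =>
        rcases hx with hx | ⟨k, rfl⟩
        · rw [Set.mem_singleton_iff.1 hx, hDa, hbg]
          exact I1.mul_mem_left _ hg1
        · have e := congrArg (pderiv k) hbg
          simp only [map_add, Derivation.leibniz, smul_eq_mul] at e
          have e2 : D (pderiv k g) = ((d : MvPolynomial (Fin 2) ℂ) * a0) * pderiv k g + g * pderiv k ((d : MvPolynomial (Fin 2) ℂ) * a0)
              - pderiv 0 g * pderiv k b0 - pderiv 1 g * pderiv k b1 := by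
            rw [hDa, pderiv_pderiv_comm' 0 k, pderiv_pderiv_comm' 1 k]
            simp only [Derivation.leibniz, smul_eq_mul]
            linear_combination e
          simp only [e2]
          exact I1.sub_mem (I1.sub_mem (I1.add_mem (I1.mul_mem_left _ (hj1 k))
            (I1.mul_mem_right _ hg1)) (I1.mul_mem_right _ (hj1 0))) (I1.mul_mem_right _ (hj1 1))
      | zero => rw [map_zero]; exact I1.zero_mem
      | add x y _ _ hx hy => rw [map_add]; exact I1.add_mem hx hy
      | smul a x hx' hx =>
        rw [smul_eq_mul, Derivation.leibniz]
        exact I1.add_mem (I1.mul_mem_left _ hx) (I1.mul_mem_right _ hx')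
    have hB := aux_deriv hzfin1 D hDI p hp1
    have hB0 := hB 0
    have hB1 := hB 1
    simp only [hDa] at hB0 hB1
    simp [pderiv_X, Pi.single_apply, hb0, hEa] at hB0
    simp [pderiv_X, Pi.single_apply, hb1, hEa] at hB1
    apply hji
    fin_cases i
    · exact hEa
    · exact hB0
    · exact hB1
end
end

section
/- Let f ∈ ℂ[x₀,x₁,x₂] be homogeneous of degree d with C = V(f) ⊆ ℙ² a singular reduced curve with only isolated singularities, not a cone. Let ρ₁,…,ρ_m, with ρⱼ = (A₀ʲ, A₁ʲ, A₂ʲ), be a minimal system of homogeneous generators of Syz(J_f), M_f the 3×m matrix with columns ρⱼ, P_f an m×(m−2) matrix whose columns generate { h ∈ R^m : M_f·h = 0 }, and N an m×3 matrix over R with M_f·N = K, the skew-symmetric Koszul matrix. In B = ℂ[x₀,x₁,x₂,y₀,y₁,y₂] form the m×(m−1) matrix S′ = (P_f | N·(y₀,y₁,y₂)ᵗ) and the forms Fᵢ = A₀ⁱy₀ + A₁ⁱy₁ + A₂ⁱy₂. Then there exists a nonzero constant c ∈ ℂ such that for every i ∈ {1,…,m}, the (m−1)×(m−1) minor of S′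 obtained by deleting the i-th row equals (−1)^{i+1}·c·Fᵢ; in particular S′·M_fᵗ·(y₀,y₁,y₂)ᵗ... the maximal minors of S′ are proportional by a common nonzero constant to the forms F₁,…,F_m. -/
open MvPolynomial

noncomputable section

/-- The skew-symmetric Koszul matrix of `f ∈ ℂ[x₀,x₁,x₂]`. -/
def koszulMat (f : MvPolynomial (Fin 3) ℂ) : Matrix (Fin 3) (Fin 3) (MvPolynomial (Fin 3) ℂ) :=
  !![0, pderiv 2 f, -(pderiv 1 f);
     -(pderiv 2 f), 0, pderiv 0 f;
     pderiv 1 f, -(pderiv 0 f), 0]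

/-- The `m×(m−1)` matrix `S′ = (P_f | N·(y₀,y₁,y₂)ᵗ)` (here `m = k+2`) over
`B = ℂ[x₀,x₁,x₂,y₀,y₁,y₂] = (ℂ[x₀,x₁,x₂])[y₀,y₁,y₂]`: its first `k` columns are the columns
of `P_f` and its last column is the vector `N·(y₀,y₁,y₂)ᵗ`. -/
def hbMatrix (k : ℕ) (P : Matrix (Fin (k + 2)) (Fin k) (MvPolynomial (Fin 3) ℂ))
    (N : Matrix (Fin (k + 2)) (Fin 3) (MvPolynomial (Fin 3) ℂ)) :
    Matrix (Fin (k + 2)) (Fin (k + 1)) (MvPolynomial (Fin 3) (MvPolynomial (Fin 3) ℂ)) :=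
  Matrix.of fun j e =>
    Fin.lastCases (∑ a, C (N j a) * X a) (fun e' => C (P j e')) e

/-- Degree drop: a polynomial dividing its own partial derivative has zero derivative. -/
lemma aux_pderiv_zero (p : MvPolynomial (Fin 3) ℂ) (i : Fin 3) (h : p ∣ pderiv i p) :
    pderiv i p = 0 := by
  by_contra hne
  obtain ⟨c, hc⟩ := h
  have hp : p ≠ 0 := by rintro rfl; simp at hne
  have hc0 : c ≠ 0 := by rintro rfl; simp [hne] at hc
  have hd : degreeOf i p ≤ degreeOf i (pderiv i p) := by
    rw [hc, degreeOf_mul_eq hp hc0]; omega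
  have hpos : 0 < degreeOf i p := by
    by_contra h0
    apply hne
    apply pderiv_eq_zero_of_notMem_vars
    intro hv
    rw [mem_vars_iff_degreeOf_ne_zero] at hv
    exact h0 (Nat.pos_of_ne_zero hv)
  have : degreeOf i (pderiv i p) < degreeOf i p := by
    rw [degreeOf_lt_iff hpos]
    intro m hm
    rw [mem_support_iff, coeff_pderiv] at hm
    have h1 : m + Finsupp.single i 1 ∈ p.support := by
      rw [mem_support_iff]; exact left_ne_zero_of_mul hm
    have := monomial_le_degreeOf i h1
    simp at this
    omega
  omega

lemma aux_const (p : MvPolynomial (Fin 3) ℂ) (h : ∀ i, pderiv i p = 0) :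
    p = C (p.coeff 0) := by
  rw [← vars_eq_empty_iff_eq_C, Finset.eq_empty_iff_forall_notMem]
  intro i hi
  rw [mem_vars_iff_mem_support] at hi
  obtain ⟨m, hm, hmi⟩ := hi
  have h1 := congrArg (coeff (m - Finsupp.single i 1)) (h i)
  have h2 : m - Finsupp.single i 1 + Finsupp.single i 1 = m :=
    Finsupp.sub_add_single_one_cancel (by simpa using hmi)
  rw [coeff_pderiv, h2, coeff_zero, mul_eq_zero] at h1
  rcases h1 with h1 | h1
  · exact (mem_support_iff.1 hm) h1
  · exact absurd h1 (Nat.cast_add_one_ne_zero _)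

/-- The partial derivatives of a reduced form have no common prime factor. -/
lemma aux_coprime (d : ℕ) (f : MvPolynomial (Fin 3) ℂ)
    (hf : f.IsHomogeneous d) (hred : Squarefree f)
    (hnz : ∃ i, pderiv i f ≠ 0)
    (p : MvPolynomial (Fin 3) ℂ) (hp : Prime p) (hdiv : ∀ i, p ∣ pderiv i f) : False := by
  have hd : d ≠ 0 := by
    rintro rfl
    obtain ⟨i, hi⟩ := hnz
    have := (totalDegree_zero_iff_isHomogeneous (p := f)).2 hf
    rw [totalDegree_eq_zero_iff_eq_C] at this
    rw [this] at hi
    simp at hi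
  have he := hf.sum_X_mul_pderiv
  have h1 : p ∣ d • f := by
    rw [← he]
    exact Finset.dvd_sum fun i _ => Dvd.dvd.mul_left (hdiv i) _
  have h2 : p ∣ f := by
    have : f = C ((d : ℂ)⁻¹) * (d • f) := by
      rw [nsmul_eq_mul, ← mul_assoc]
      have : (C ((d : ℂ)⁻¹) * (d : MvPolynomial (Fin 3) ℂ)) = 1 := by
        rw [← map_natCast (C : ℂ →+* MvPolynomial (Fin 3) ℂ), ← C_mul,
          inv_mul_cancel₀ (by exact_mod_cast hd), C_1]
      rw [this, one_mul]
    rw [this]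
    exact Dvd.dvd.mul_left h1 _
  obtain ⟨g, rfl⟩ := h2
  have hg : ¬ p ∣ g := by
    rintro ⟨r, rfl⟩
    exact hp.not_isUnit (hred p ⟨r, by ring⟩)
  have h3 : ∀ i, pderiv i p = 0 := by
    intro i
    apply aux_pderiv_zero
    have := hdiv i
    rw [pderiv_mul, dvd_add_left (Dvd.intro _ rfl)] at this
    exact (hp.dvd_or_dvd this).resolve_right hg
  have h4 := aux_const p h3
  apply hp.not_isUnit
  rw [h4]
  apply IsUnit.map
  rw [isUnit_iff_ne_zero]
  intro h5
  rw [h5, C_0] at h4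
  exact hp.ne_zero h4

/-- Cramer: if `F` is in the left kernel of an `(n+1)×n` matrix, it is proportional to the
vector of signed maximal minors. -/
lemma aux_cramer {A : Type*} [CommRing A] {n : ℕ} (S : Matrix (Fin (n + 1)) (Fin n) A)
    (F : Fin (n + 1) → A) (hF : ∀ e, ∑ j, F j * S j e = 0) (i j : Fin (n + 1)) :
    ((-1) ^ (i : ℕ) * (S.submatrix i.succAbove id).det) * F j =
      F i * ((-1) ^ (j : ℕ) * (S.submatrix j.succAbove id).det) := by
  let T : Matrix (Fin (n + 1)) (Fin (n + 1)) A :=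
    Matrix.of fun a b => (Fin.cons (if a = i then 1 else 0) (S a) : Fin (n + 1) → A) b
  have hsub : ∀ a : Fin (n + 1), T.submatrix a.succAbove Fin.succ = S.submatrix a.succAbove id := by
    intro a; ext b c; simp [T]
  have hadj : ∀ a, T.adjugate 0 a = (-1) ^ (a : ℕ) * (S.submatrix a.succAbove id).det := by
    intro a
    rw [Matrix.adjugate_fin_succ_eq_det_submatrix]
    have : (Fin.succAbove (0 : Fin (n + 1))) = Fin.succ := by ext x; simp
    rw [this, hsub]
    simp
  have hdet : T.det = (-1) ^ (i : ℕ) * (S.submatrix i.succAbove id).det := by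
    rw [Matrix.det_succ_column_zero]
    rw [Finset.sum_eq_single i]
    · rw [hsub]; simp [T]
    · intro b _ hb; simp [T, hb]
    · simp
  have hFT : Matrix.vecMul F T = Pi.single 0 (F i) := by
    ext b
    refine Fin.cases ?_ (fun e => ?_) b
    · simp [Matrix.vecMul, dotProduct, T]
    · simpa [Matrix.vecMul, dotProduct, T] using hF e
  have h1 : Matrix.vecMul (Matrix.vecMul F T) T.adjugate = Matrix.vecMul F (T * T.adjugate) := by
    rw [Matrix.vecMul_vecMul]
  rw [Matrix.mul_adjugate, hFT] at h1
  have h2 := congrFun h1 j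
  simp only [Matrix.single_vecMul, Matrix.vecMul_smul, Matrix.vecMul_one, Pi.smul_apply, smul_eq_mul, Matrix.row] at h2
  rw [hdet] at h2
  rw [← h2, hadj]

/-- An injective `(n+1)×n` matrix over a field has a nonzero maximal minor. -/
lemma aux_minor_field {L : Type*} [Field L] {n : ℕ} (S : Matrix (Fin (n + 1)) (Fin n) L)
    (hS : LinearIndependent L S.col) : ∃ i : Fin (n + 1), (S.submatrix i.succAbove id).det ≠ 0 := by
  have hlt : Submodule.span L (Set.range S.col) ≠ ⊤ := by
    intro h
    have h1 := finrank_span_eq_card hS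
    rw [h] at h1
    simp at h1
  obtain ⟨w, hw⟩ : ∃ w, w ∉ Submodule.span L (Set.range S.col) := by
    by_contra! hh
    exact hlt (Submodule.eq_top_iff'.2 hh)
  let T : Matrix (Fin (n + 1)) (Fin (n + 1)) L :=
    Matrix.of fun a b => (Fin.cons (w a) (S a) : Fin (n + 1) → L) b
  have hT : T.col = Fin.cons w S.col := by
    ext b a
    refine Fin.cases ?_ (fun e => ?_) b <;> rfl
  have hli : LinearIndependent L T.col := by
    rw [hT]; exact linearIndependent_finCons.2 ⟨hS, hw⟩
  rw [Matrix.linearIndependent_cols_iff_isUnit, Matrix.isUnit_iff_isUnit_det,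
    isUnit_iff_ne_zero] at hli
  by_contra! h0
  apply hli
  rw [Matrix.det_succ_column_zero]
  apply Finset.sum_eq_zero
  intro i _
  have hsub : T.submatrix i.succAbove Fin.succ = S.submatrix i.succAbove id := by
    ext b c; simp [T]
  rw [hsub, h0, mul_zero]

lemma aux_minor {D : Type*} [CommRing D] [IsDomain D] {n : ℕ} (S : Matrix (Fin (n + 1)) (Fin n) D)
    (hS : ∀ v : Fin n → D, (∀ j, ∑ e, S j e * v e = 0) → v = 0) :
    ∃ i : Fin (n + 1), (S.submatrix i.succAbove id).det ≠ 0 := by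
  let L := FractionRing D
  have hinj : Function.Injective (algebraMap D L) := IsFractionRing.injective D L
  have hli : LinearIndependent L (S.map (algebraMap D L)).col := by
    rw [← LinearIndependent.iff_fractionRing D L, Fintype.linearIndependent_iff]
    intro g hg
    have := hS g (by
      intro j
      have h1 := congrFun hg j
      apply hinj
      rw [map_sum, map_zero]
      rw [Finset.sum_apply, Pi.zero_apply] at h1
      rw [← h1]
      refine Finset.sum_congr rfl fun e _ => ?_
      rw [map_mul, mul_comm, Pi.smul_apply, Algebra.smul_def]
      rfl)
    intro i; rw [this]; rfl
  obtain ⟨i, hi⟩ := aux_minor_field _ hli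
  refine ⟨i, fun h => hi ?_⟩
  rw [Matrix.submatrix_map, ← RingHom.mapMatrix_apply, ← RingHom.map_det, h, map_zero]

/-- Two proportional primitive vectors over a UFD differ by a unit. -/
lemma aux_ufd {A : Type*} [CommRing A] [IsDomain A] [UniqueFactorizationMonoid A] {ι : Type*}
    (D F : ι → A) (h : ∀ i j, D i * F j = F i * D j) (hex : ∃ q : A, Prime q)
    (hD : ∀ q : A, Prime q → ¬ ∀ i, q ∣ D i) (hF : ∀ q : A, Prime q → ¬ ∀ i, q ∣ F i) :
    ∃ u : A, IsUnit u ∧ ∀ i, D i = u * F i := by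
  obtain ⟨q0, hq0⟩ := hex
  obtain ⟨j, hj⟩ : ∃ j, F j ≠ 0 := by
    by_contra! h0
    exact hF q0 hq0 fun i => by rw [h0]; exact dvd_zero _
  obtain ⟨a, b, c, hrel, ha, hb⟩ := UniqueFactorizationMonoid.exists_reduced_factors' (D j) (F j) hj
  have hc : c ≠ 0 := by rintro rfl; apply hj; rw [← hb, zero_mul]
  have hb0 : b ≠ 0 := by rintro rfl; apply hj; rw [← hb, mul_zero]
  have key : ∀ i, b * D i = a * F i := by
    intro i
    apply mul_left_cancel₀ hc
    have := h i j
    rw [← ha, ← hb] at this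
    linear_combination this
  have ha0 : a ≠ 0 := by
    rintro rfl
    apply hD q0 hq0
    intro i
    have := key i
    rw [zero_mul, mul_eq_zero] at this
    rw [this.resolve_left hb0]; exact dvd_zero _
  have hbu : IsUnit b := by
    by_contra hnu
    obtain ⟨q, hq, hqb⟩ := WfDvdMonoid.exists_irreducible_factor hnu hb0
    have hqp := UniqueFactorizationMonoid.irreducible_iff_prime.1 hq
    apply hF q hqp
    intro i
    have h1 : q ∣ a * F i := by rw [← key]; exact Dvd.dvd.mul_right hqb _
    exact (hqp.dvd_or_dvd h1).resolve_left fun h2 => hqp.not_isUnit (hrel h2 hqb)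
  have hau : IsUnit a := by
    by_contra hnu
    obtain ⟨q, hq, hqb⟩ := WfDvdMonoid.exists_irreducible_factor hnu ha0
    have hqp := UniqueFactorizationMonoid.irreducible_iff_prime.1 hq
    apply hD q hqp
    intro i
    have h1 : q ∣ b * D i := by rw [key]; exact Dvd.dvd.mul_right hqb _
    exact (hqp.dvd_or_dvd h1).resolve_left fun h2 => hqp.not_isUnit (hrel hqb h2)
  obtain ⟨ub, rfl⟩ := hbu
  refine ⟨(↑ub⁻¹ : A) * a, ub⁻¹.isUnit.mul hau, fun i => ?_⟩
  rw [mul_assoc, ← key, ← mul_assoc, Units.inv_mul, one_mul]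

/-- A square-like rank count: a surjection from a rank-`k` free module onto the kernel of a
map `R^{k+2} → R^3` whose image lies in the kernel of a nonzero functional is injective. -/
lemma aux_inj {R : Type} [CommRing R] [IsDomain R] [IsNoetherianRing R] (k : ℕ) (g : Fin 3 → R) (hg : g ≠ 0)
    (ρ : Fin (k + 2) → Fin 3 → R) (hsyz : ∀ j, ∑ i, ρ j i * g i = 0)
    (P : Matrix (Fin (k + 2)) (Fin k) R)
    (hPgen : ∀ h : Fin (k + 2) → R, (∀ i, ∑ j, ρ j i * h j = 0) →
        h ∈ Submodule.span R (Set.range fun c : Fin k => fun j => P j c))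
    (v : Fin k → R) (hv : ∀ j, ∑ e, P j e * v e = 0) : v = 0 := by
  let M : Matrix (Fin 3) (Fin (k + 2)) R := Matrix.of fun i j => ρ j i
  let φ : (Fin 3 → R) →ₗ[R] R := ∑ i, g i • LinearMap.proj i
  have hφ : ∀ x, φ x = ∑ i, g i * x i := by intro x; simp [φ]
  have rn : ∀ {a b : ℕ} (l : (Fin a → R) →ₗ[R] (Fin b → R)),
      Module.finrank R (LinearMap.range l) + Module.finrank R (LinearMap.ker l) = a := by
    intro a b l
    rw [← l.quotKerEquivRange.finrank_eq, Submodule.finrank_quotient_add_finrank]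
    simp
  have h1 : Module.finrank R (LinearMap.range φ) + Module.finrank R (LinearMap.ker φ) = 3 := by
    rw [← φ.quotKerEquivRange.finrank_eq, Submodule.finrank_quotient_add_finrank]
    simp
  have h2 : Module.finrank R (LinearMap.range φ) ≠ 0 := by
    intro h
    rw [Submodule.finrank_eq_zero, LinearMap.range_eq_bot] at h
    apply hg
    ext i
    have := hφ (Pi.single i 1)
    rw [h] at this
    simpa [Pi.single_apply] using this.symm
  have h3 : LinearMap.range M.mulVecLin ≤ LinearMap.ker φ := by
    rintro _ ⟨x, rfl⟩
    rw [LinearMap.mem_ker, hφ]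
    simp only [Matrix.mulVecLin_apply, Matrix.mulVec, dotProduct, M, Matrix.of_apply,
      Finset.mul_sum]
    rw [Finset.sum_comm]
    apply Finset.sum_eq_zero
    intro j _
    have := hsyz j
    calc _ = (∑ i, ρ j i * g i) * x j := by
          rw [Finset.sum_mul]; exact Finset.sum_congr rfl fun i _ => by ring
      _ = 0 := by rw [this, zero_mul]
  have h4 := Submodule.finrank_mono h3
  have h5 := rn M.mulVecLin
  have h6 : LinearMap.ker M.mulVecLin ≤ LinearMap.range P.mulVecLin := by
    intro h hh
    rw [Matrix.range_mulVecLin]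
    apply hPgen
    intro i
    exact congrFun hh i
  have h7 := Submodule.finrank_mono h6
  have h8 := rn P.mulVecLin
  have h9 : Module.finrank R (LinearMap.ker P.mulVecLin) = 0 := by omega
  rw [Submodule.finrank_eq_zero] at h9
  have : v ∈ LinearMap.ker P.mulVecLin := by
    rw [LinearMap.mem_ker]; ext j; exact hv j
  rw [h9] at this
  simpa using this

/-- The three coordinates of `K·y` have no common prime factor in `B`. -/
lemma aux_koszul (f : MvPolynomial (Fin 3) ℂ) (hne : ∀ i, pderiv i f ≠ 0)
    (hcop : ∀ p : MvPolynomial (Fin 3) ℂ, Prime p → ¬ ∀ i, p ∣ pderiv i f)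
    (q : MvPolynomial (Fin 3) (MvPolynomial (Fin 3) ℂ)) (hq : Prime q)
    (hdiv : ∀ i, q ∣ ∑ a, C (koszulMat f i a) * X a) : False := by
  have gen : ∀ (i b c : Fin 3) (u v : MvPolynomial (Fin 3) ℂ), u ≠ 0 → i ≠ b → i ≠ c → b ≠ c →
      q ∣ (C u * X b + C v * X c : MvPolynomial (Fin 3) (MvPolynomial (Fin 3) ℂ)) →
      degreeOf i q = 0 := by
    intro i b c u v hu hib hic hbc ⟨r, hr⟩
    have hnz : (C u * X b + C v * X c : MvPolynomial (Fin 3) (MvPolynomial (Fin 3) ℂ)) ≠ 0 := by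
      intro h
      have := congrArg (coeff (Finsupp.single b 1)) h
      simp [coeff_C_mul, coeff_X, Finsupp.single_left_inj, hbc.symm] at this
      exact hu this
    have hdeg : degreeOf i
        (C u * X b + C v * X c : MvPolynomial (Fin 3) (MvPolynomial (Fin 3) ℂ)) = 0 := by
      have h1 := degreeOf_add_le i (C u * X b : MvPolynomial (Fin 3) (MvPolynomial (Fin 3) ℂ))
        (C v * X c)
      have h2 := degreeOf_C_mul_le (X b : MvPolynomial (Fin 3) (MvPolynomial (Fin 3) ℂ)) i u
      have h3 := degreeOf_C_mul_le (X c : MvPolynomial (Fin 3) (MvPolynomial (Fin 3) ℂ)) i v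
      rw [degreeOf_X_of_ne hib] at h2
      rw [degreeOf_X_of_ne hic] at h3
      omega
    have hr0 : r ≠ 0 := by rintro rfl; rw [mul_zero] at hr; exact hnz hr
    rw [hr, degreeOf_mul_eq hq.ne_zero hr0] at hdeg
    omega
  have e0 := hdiv 0
  have e1 := hdiv 1
  have e2 := hdiv 2
  simp only [koszulMat, Fin.sum_univ_three, Matrix.of_apply, Matrix.cons_val_zero,
    Matrix.cons_val_one, Matrix.cons_val, C_0, zero_mul, zero_add, add_zero] at e0 e1 e2
  have d0 := gen 0 1 2 _ _ (hne 2) (by decide) (by decide) (by decide) e0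
  have d1 := gen 1 0 2 _ _ (neg_ne_zero.2 (hne 2)) (by decide) (by decide) (by decide) e1
  have d2 := gen 2 0 1 _ _ (hne 1) (by decide) (by decide) (by decide) e2
  have hqC : q = C (q.coeff 0) := by
    rw [← vars_eq_empty_iff_eq_C, Finset.eq_empty_iff_forall_notMem]
    intro i hi
    rw [mem_vars_iff_degreeOf_ne_zero] at hi
    fin_cases i
    · exact hi d0
    · exact hi d1
    · exact hi d2
  rw [hqC] at hq e0 e1
  rw [prime_C_iff] at hq
  apply hcop _ hq
  rw [C_dvd_iff_dvd_coeff] at e0 e1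
  have a0 := e0 (Finsupp.single 1 1)
  have a1 := e0 (Finsupp.single 2 1)
  have a2 := e1 (Finsupp.single 2 1)
  simp only [coeff_add, coeff_C_mul, coeff_X, Finsupp.single_left_inj one_ne_zero] at a0 a1 a2
  intro i
  fin_cases i
  · simpa using a2
  · simpa using a1
  · simpa using a0

/-- Exactness of `P, M` is preserved by adjoining the variables `y`. -/
lemma aux_ext {R : Type} [CommRing R] (k : ℕ)
    (ρ : Fin (k + 2) → Fin 3 → R)
    (P : Matrix (Fin (k + 2)) (Fin k) R)
    (hPgen : ∀ h : Fin (k + 2) → R, (∀ i, ∑ j, ρ j i * h j = 0) →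
        h ∈ Submodule.span R (Set.range fun c : Fin k => fun j => P j c))
    (w : Fin (k + 2) → MvPolynomial (Fin 3) R) (hw : ∀ i, ∑ j, C (ρ j i) * w j = 0) :
    ∃ v : Fin k → MvPolynomial (Fin 3) R, ∀ j, w j = ∑ e, C (P j e) * v e := by
  classical
  have h1 : ∀ s, ∃ h : Fin k → R, ∀ j, coeff s (w j) = ∑ e, P j e * h e := by
    intro s
    have := hPgen (fun j => coeff s (w j)) (by
      intro i
      have := congrArg (coeff s) (hw i)
      simpa [coeff_sum, coeff_C_mul] using this)
    rw [Submodule.mem_span_range_iff_exists_fun] at this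
    obtain ⟨h, hh⟩ := this
    refine ⟨h, fun j => ?_⟩
    have := congrFun hh j
    rw [← this]
    simp [mul_comm]
  choose h hh using h1
  let T := Finset.univ.biUnion fun j => (w j).support
  refine ⟨fun e => ∑ s ∈ T, monomial s (h s e), fun j => ?_⟩
  have h2 : w j = ∑ s ∈ T, monomial s (coeff s (w j)) := by
    conv_lhs => rw [as_sum (w j)]
    apply Finset.sum_subset
    · exact Finset.subset_biUnion_of_mem (fun j => (w j).support) (Finset.mem_univ j)
    · intro s _ hs
      rw [notMem_support_iff.1 hs, monomial_zero]
  rw [h2]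
  simp only [Finset.mul_sum, C_mul_monomial]
  rw [Finset.sum_comm]
  refine Finset.sum_congr rfl fun s _ => ?_
  rw [hh, map_sum]

lemma aux_inj_ext {R : Type} [CommRing R] (k : ℕ) (P : Matrix (Fin (k + 2)) (Fin k) R)
    (hP : ∀ v : Fin k → R, (∀ j, ∑ e, P j e * v e = 0) → v = 0)
    (v : Fin k → MvPolynomial (Fin 3) R) (hv : ∀ j, ∑ e, C (P j e) * v e = 0) : v = 0 := by
  ext e s
  have := hP (fun e => coeff s (v e)) (by
    intro j
    have := congrArg (coeff s) (hv j)
    simpa [coeff_sum, coeff_C_mul] using this)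
  simpa using congrFun this e

lemma aux_sign {A : Type*} [CommRing A] (n : ℕ) (x : A) :
    x = (-1) ^ n * ((-1) ^ n * x) := by
  rw [← mul_assoc, ← pow_add, Even.neg_one_pow ⟨n, rfl⟩, one_mul]

/-- Lemma 4.5: with the notation of Proposition 4.4 (here `m = k + 2`), the matrix
`S′ = (P_f | N·(y₀,y₁,y₂)ᵗ)` is the Hilbert–Burch matrix of `Z_f`: there is a nonzero
constant `c ∈ ℂ` such that for each `i ∈ {1,…,m}` the maximal minor of `S′` obtained by
deleting the `i`-th row equals `(−1)^{i+1}·c·Fᵢ` (with `1`-based row index `i`; in the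
`0`-based indexing used here the sign is `(−1)^i`). -/
theorem stmt_16 (d k : ℕ) (f : MvPolynomial (Fin 3) ℂ)
    (hf : f.IsHomogeneous d) (hred : Squarefree f)
    (hsing : ∃ q : Fin 3 → ℂ, q ≠ 0 ∧ ∀ i, eval q (pderiv i f) = 0)
    (hiso : {P : Projectivization ℂ (Fin 3 → ℂ) |
      ∀ i, eval P.rep (pderiv i f) = 0}.Finite)
    (hnc : LinearIndependent ℂ ![pderiv 0 f, pderiv 1 f, pderiv 2 f])
    (ρ : Fin (k + 2) → Fin 3 → MvPolynomial (Fin 3) ℂ)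
    (dd : Fin (k + 2) → ℕ) (hhom : ∀ j i, (ρ j i).IsHomogeneous (dd j))
    (hsyz : ∀ j, ∑ i, ρ j i * pderiv i f = 0)
    (hgen : ∀ A : Fin 3 → MvPolynomial (Fin 3) ℂ,
      (∑ i, A i * pderiv i f = 0) →
        A ∈ Submodule.span (MvPolynomial (Fin 3) ℂ) (Set.range ρ))
    (hmin : ∀ j, ρ j ∉ Submodule.span (MvPolynomial (Fin 3) ℂ) (ρ '' {j' | j' ≠ j}))
    (P : Matrix (Fin (k + 2)) (Fin k) (MvPolynomial (Fin 3) ℂ))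
    (hPsyz : ∀ c i, ∑ j, ρ j i * P j c = 0)
    (hPgen : ∀ h : Fin (k + 2) → MvPolynomial (Fin 3) ℂ,
      (∀ i, ∑ j, ρ j i * h j = 0) →
        h ∈ Submodule.span (MvPolynomial (Fin 3) ℂ)
          (Set.range fun c : Fin k => fun j => P j c))
    (N : Matrix (Fin (k + 2)) (Fin 3) (MvPolynomial (Fin 3) ℂ))
    (hN : (Matrix.of fun i j => ρ j i) * N = koszulMat f) :
    ∃ c : ℂ, c ≠ 0 ∧
      ∀ i : Fin (k + 2),
        ((hbMatrix k P N).submatrix i.succAbove id).det =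
          (-1 : MvPolynomial (Fin 3) (MvPolynomial (Fin 3) ℂ)) ^ (i : ℕ) *
            algebraMap ℂ (MvPolynomial (Fin 3) (MvPolynomial (Fin 3) ℂ)) c *
            (∑ a, C (ρ i a) * X a) := by
  have hne : ∀ i, pderiv i f ≠ 0 := by
    intro i
    have := hnc.ne_zero i
    fin_cases i <;> simpa using this
  have hcop : ∀ p : MvPolynomial (Fin 3) ℂ, Prime p → ¬ ∀ i, p ∣ pderiv i f :=
    fun p hp h => aux_coprime d f hf hred ⟨0, hne 0⟩ p hp h
  have hPinj := aux_inj k (fun i => pderiv i f) (fun h => hne 0 (congrFun h 0)) ρ hsyz P hPgen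
  have hPinjB := aux_inj_ext k P hPinj
  have hK : ∀ i a, ∑ j, ρ j i * N j a = koszulMat f i a := by
    intro i a
    rw [← hN]; rfl
  have hScast : ∀ j (e : Fin k), hbMatrix k P N j e.castSucc = C (P j e) := by
    intro j e; simp [hbMatrix]
  have hSlast : ∀ j, hbMatrix k P N j (Fin.last k) = ∑ a, C (N j a) * X a := by
    intro j; simp [hbMatrix]
  let F : Fin (k + 2) → MvPolynomial (Fin 3) (MvPolynomial (Fin 3) ℂ) :=
    fun j => ∑ a, C (ρ j a) * X a
  have hMN : ∀ i, ∑ j, C (ρ j i) * (∑ a, C (N j a) * X a) =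
      ∑ a, (C (koszulMat f i a) * X a : MvPolynomial (Fin 3) (MvPolynomial (Fin 3) ℂ)) := by
    intro i
    simp only [Finset.mul_sum]
    rw [Finset.sum_comm]
    refine Finset.sum_congr rfl fun a _ => ?_
    rw [← hK, map_sum, Finset.sum_mul]
    refine Finset.sum_congr rfl fun j _ => ?_
    rw [C_mul, mul_assoc]
  have hMP : ∀ i e, ∑ j, (C (ρ j i) * C (P j e) :
      MvPolynomial (Fin 3) (MvPolynomial (Fin 3) ℂ)) = 0 := by
    intro i e
    rw [← C_0, ← hPsyz e i, map_sum]
    exact Finset.sum_congr rfl fun j _ => (C_mul).symm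
  have hFS : ∀ e, ∑ j, F j * hbMatrix k P N j e = 0 := by
    have swap : ∀ t : Fin (k + 2) → MvPolynomial (Fin 3) (MvPolynomial (Fin 3) ℂ),
        ∑ j, F j * t j = ∑ i, X i * ∑ j, C (ρ j i) * t j := by
      intro t
      simp only [F, Finset.sum_mul, Finset.mul_sum]
      rw [Finset.sum_comm]
      refine Finset.sum_congr rfl fun a _ => Finset.sum_congr rfl fun j _ => ?_
      ring
    intro e
    rw [swap]
    refine Fin.lastCases ?_ (fun e' => ?_) e
    · simp only [hSlast, hMN]
      simp [koszulMat, Fin.sum_univ_three]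
      ring
    · simp only [hScast, hMP, mul_zero, Finset.sum_const_zero]
  have hFprim : ∀ q, Prime q → ¬ ∀ i, q ∣ F i := by
    intro q hq h
    apply aux_koszul f hne hcop q hq
    intro i
    have : (∑ a, (C (koszulMat f i a) * X a : MvPolynomial (Fin 3) (MvPolynomial (Fin 3) ℂ))) =
        - ∑ j, C (N j i) * F j := by
      have h1 : ∑ j, C (N j i) * F j =
          ∑ a, (C (koszulMat f a i) * X a : MvPolynomial (Fin 3) (MvPolynomial (Fin 3) ℂ)) := by
        simp only [F, Finset.mul_sum]
        rw [Finset.sum_comm]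
        refine Finset.sum_congr rfl fun a _ => ?_
        rw [← hK, map_sum, Finset.sum_mul]
        refine Finset.sum_congr rfl fun j _ => ?_
        rw [C_mul]; ring
      rw [h1, ← Finset.sum_neg_distrib]
      refine Finset.sum_congr rfl fun a _ => ?_
      have : koszulMat f i a = - koszulMat f a i := by
        fin_cases i <;> fin_cases a <;> simp [koszulMat]
      rw [this, C_neg]; ring
    obtain ⟨t, ht⟩ : q ∣ ∑ j, C (N j i) * F j :=
      Finset.dvd_sum fun j _ => Dvd.dvd.mul_left (h j) _
    exact ⟨-t, by rw [this, ht]; ring⟩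
  let Δ : Fin (k + 2) → MvPolynomial (Fin 3) (MvPolynomial (Fin 3) ℂ) :=
    fun i => (-1) ^ (i : ℕ) * ((hbMatrix k P N).submatrix i.succAbove id).det
  have hΔprim : ∀ q, Prime q → ¬ ∀ i, q ∣ Δ i := by
    intro q hq h
    have hprime : (Ideal.span {q}).IsPrime := (Ideal.span_singleton_prime hq.ne_zero).2 hq
    let π := Ideal.Quotient.mk (Ideal.span {q})
    have hπ : ∀ x, π x = 0 ↔ q ∣ x := by
      intro x
      rw [Ideal.Quotient.eq_zero_iff_mem, Ideal.mem_span_singleton]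
    obtain ⟨i, hi⟩ := aux_minor ((hbMatrix k P N).map π) (by
      intro vb hvb
      obtain ⟨v, rfl⟩ : ∃ v, vb = fun e => π (v e) :=
        ⟨fun e => Function.surjInv Ideal.Quotient.mk_surjective (vb e),
          funext fun e => (Function.surjInv_eq Ideal.Quotient.mk_surjective (vb e)).symm⟩
      have h1 : ∀ j, q ∣ (∑ e, C (P j e) * v (Fin.castSucc e)) +
          (∑ a, C (N j a) * X a) * v (Fin.last k) := by
        intro j
        rw [← hπ, ← hvb j, ← hSlast]
        simp only [← hScast]
        rw [← Fin.sum_univ_castSucc (fun e => hbMatrix k P N j e * v e), map_sum]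
        simp
      have hker : ∀ (u : Fin k → MvPolynomial (Fin 3) (MvPolynomial (Fin 3) ℂ)) i,
          ∑ j, C (ρ j i) * (∑ e, C (P j e) * u e) = 0 := by
        intro u i
        simp only [Finset.mul_sum]
        rw [Finset.sum_comm]
        apply Finset.sum_eq_zero
        intro e _
        simp only [← mul_assoc]
        rw [← Finset.sum_mul, hMP, zero_mul]
      have h2 : ∀ i, q ∣ (∑ a, C (koszulMat f i a) * X a) * v (Fin.last k) := by
        intro i
        have : (∑ a, C (koszulMat f i a) * X a) * v (Fin.last k) =
            ∑ j, C (ρ j i) * ((∑ e, C (P j e) * v (Fin.castSucc e)) +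
              (∑ a, C (N j a) * X a) * v (Fin.last k)) := by
          simp only [mul_add, Finset.sum_add_distrib]
          rw [hker, zero_add, ← hMN, Finset.sum_mul]
          exact Finset.sum_congr rfl fun j _ => by rw [mul_assoc]
        rw [this]
        exact Finset.dvd_sum fun j _ => Dvd.dvd.mul_left (h1 j) _
      have h3 : q ∣ v (Fin.last k) := by
        by_contra hn
        exact aux_koszul f hne hcop q hq fun i => (hq.dvd_or_dvd (h2 i)).resolve_right hn
      have h4 : ∀ j, q ∣ ∑ e, C (P j e) * v (Fin.castSucc e) := fun j =>
        (dvd_add_left (Dvd.dvd.mul_left h3 _)).1 (h1 j)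
      choose w hw using h4
      obtain ⟨v', hv'⟩ := aux_ext k ρ P hPgen w (by
        intro i
        apply mul_left_cancel₀ hq.ne_zero
        rw [mul_zero, ← hker (fun e => v (Fin.castSucc e)) i, Finset.mul_sum]
        refine Finset.sum_congr rfl fun j _ => ?_
        rw [hw]; ring)
      have h5 := hPinjB (fun e => v (Fin.castSucc e) - q * v' e) (by
        intro j
        simp only [mul_sub, Finset.sum_sub_distrib]
        rw [hw, hv', Finset.mul_sum, sub_eq_zero]
        exact Finset.sum_congr rfl fun e _ => by ring)
      ext e
      change π (v e) = 0
      rw [hπ]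
      refine Fin.lastCases h3 (fun e' => ?_) e
      have := congrFun h5 e'
      exact ⟨v' e', sub_eq_zero.1 this⟩)
    apply hi
    rw [Matrix.submatrix_map, ← RingHom.mapMatrix_apply, ← RingHom.map_det, hπ]
    have h6 := h i
    have h7 : ((hbMatrix k P N).submatrix i.succAbove id).det = (-1) ^ (i : ℕ) * Δ i :=
      aux_sign _ _
    rw [h7]
    exact Dvd.dvd.mul_left h6 _
  obtain ⟨u, hu, huF⟩ := aux_ufd Δ F (fun i j => aux_cramer (hbMatrix k P N) F hFS i j)
    ⟨X 0, X_prime⟩ hΔprim hFprim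
  obtain ⟨r, hr, rfl⟩ := isUnit_iff_eq_C_of_isReduced.1 hu
  obtain ⟨c, hc, rfl⟩ := isUnit_iff_eq_C_of_isReduced.1 hr
  refine ⟨c, hc.ne_zero, fun i => ?_⟩
  have h7 : ((hbMatrix k P N).submatrix i.succAbove id).det = (-1) ^ (i : ℕ) * Δ i :=
    aux_sign _ _
  rw [h7, huF i, mul_assoc]
  rfl
end
end
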